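/- arXiv:2308.04408 — 3 statements merged into one kernel-verified Lean document; each statement's English description precedes it below -/
import Mathlib

section
/- Let C, A and B be groups and let ι_A : C → A and ι_B : C → B be injective group homomorphisms such that the image of ι_A is contained in the center of A and is a proper subgroup of A, and the image of ι_B is contained in the center of B and is a proper subgroup of B. Let G = A *_C B be the amalgamated free product of A and B over C, with canonical homomorphisms κ_A : A → G and κ_B : B → G. Then: (1) for every a ∈ A with a not in the image of ι_A, the centralizer of κ_A(a) in G equals the image under κ_A of the centralizer of a in A; and (2) the center of G equals the image κ_A(ι_A(C)) of C in G. -/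
/-- The two-element-indexed family of groups, with value `A` at `true` and `B` at `false`. -/
def amalgFam (A B : Type) : Bool → Type := fun i => cond i A B

instance amalgFamGroup (A B : Type) [Group A] [Group B] : ∀ i, Group (amalgFam A B i)
  | true => ‹Group A›
  | false => ‹Group B›

/-- The pair of monomorphisms `ι_A : C → A`, `ι_B : C → B`, packaged as a family
indexed by `Bool`. -/
def amalgMaps {A B C : Type} [Group A] [Group B] [Group C]
    (ιA : C →* A) (ιB : C →* B) : ∀ i, C →* amalgFam A B i
  | true => ιA
  | false => ιB

theorem Subgroup.normal_of_le_center {G : Type*} [Group G] {K : Subgroup G}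
    (hK : K ≤ Subgroup.center G) : K.Normal :=
  ⟨fun n hn g => by rwa [Subgroup.mem_center_iff.1 (hK hn) g, mul_inv_cancel_right]⟩

namespace Monoid.PushoutI

open CoprodI

variable {ι H : Type*} {G : ι → Type*} [∀ i, Group (G i)] [Group H] {φ : ∀ i, H →* G i}

theorem reduced_singleton {i : ι} {x : G i} (hx : x ∉ (φ i).range) (h1 : x ≠ 1) :
    Reduced φ (NeWord.singleton x h1).toWord := by
  intro g hg
  have hg' : g = ⟨i, x⟩ := by simpa [NeWord.toWord, NeWord.toList] using hg
  subst hg'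
  exact hx

theorem reduced_append_iff {i j k l : ι} {w₁ : NeWord G i j} {hne : j ≠ k} {w₂ : NeWord G k l} :
    Reduced φ (NeWord.append w₁ hne w₂).toWord ↔ Reduced φ w₁.toWord ∧ Reduced φ w₂.toWord := by
  simp only [Reduced, NeWord.toWord, NeWord.toList, List.mem_append, or_imp, forall_and]

theorem Reduced.inv {i j : ι} {w : NeWord G i j} (hw : Reduced φ w.toWord) :
    Reduced φ w.inv.toWord := by
  induction w with
  | singleton x h1 =>
    refine reduced_singleton (fun h => ?_) _
    exact hw ⟨_, x⟩ (by simp [NeWord.toWord, NeWord.toList]) (inv_mem_iff.1 h)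
  | append w₁ hne w₂ ih₁ ih₂ =>
    rw [reduced_append_iff] at hw
    exact reduced_append_iff.2 ⟨ih₂ hw.2, ih₁ hw.1⟩

theorem ne_one_of_notMem_range {i : ι} {x : G i} (hx : x ∉ (φ i).range) : x ≠ 1 :=
  fun h => hx (h ▸ one_mem _)

/-- Conjugating an element `c` of a factor that avoids the base by a reduced word starting in `G j`
gives a reduced word starting and ending in `G j`. -/
theorem Reduced.exists_conj_eq {i j k : ι} (hn : (φ i).range.Normal) {c : G i}
    (hc : c ∉ (φ i).range) (w : NeWord G j k) (hw : Reduced φ w.toWord) :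
    ∃ v : NeWord G j j, Reduced φ v.toWord ∧
      (ofCoprodI v.prod : PushoutI φ) =
        ofCoprodI w.prod * of i c * (ofCoprodI w.prod)⁻¹ := by
  induction w with
  | @singleton j x h1 =>
    by_cases hji : j = i
    · subst hji
      have hc' : x * c * x⁻¹ ∉ (φ j).range := fun h => hc <| by
        simpa [mul_assoc] using hn.conj_mem _ h x⁻¹
      exact ⟨.singleton _ (ne_one_of_notMem_range hc'), reduced_singleton hc' _, by simp⟩
    · refine ⟨.append (.append (.singleton x h1) hji
        (.singleton c (ne_one_of_notMem_range hc))) (Ne.symm hji) (NeWord.singleton x h1).inv,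
        ?_, by simp⟩
      exact reduced_append_iff.2
        ⟨reduced_append_iff.2 ⟨hw, reduced_singleton hc _⟩, hw.inv⟩
  | append w₁ hne w₂ _ ih₂ =>
    rw [reduced_append_iff] at hw
    obtain ⟨v, hv, hvc⟩ := ih₂ hw.2
    refine ⟨.append (.append w₁ hne v) hne.symm w₁.inv, ?_, ?_⟩
    · exact reduced_append_iff.2 ⟨reduced_append_iff.2 ⟨hw.1, hv⟩, hw.1.inv⟩
    · simp [hvc, mul_assoc]

theorem Reduced.ofCoprodI_prod_notMem_base_range (hφ : ∀ i, Function.Injective (φ i)) {j k : ι}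
    {w : NeWord G j k} (hw : Reduced φ w.toWord) :
    (ofCoprodI w.prod : PushoutI φ) ∉ (base φ).range := fun h =>
  w.toList_ne_nil (congrArg Word.toList (hw.eq_empty_of_mem_range hφ h))

theorem Reduced.ofCoprodI_prod_notMem_of_range (hφ : ∀ i, Function.Injective (φ i)) {i j k : ι}
    (hki : k ≠ i) {w : NeWord G j k} (hw : Reduced φ w.toWord) :
    (ofCoprodI w.prod : PushoutI φ) ∉ (of (φ := φ) i).range := by
  rintro ⟨c, hc⟩
  by_cases hcr : c ∈ (φ i).range
  · obtain ⟨h, rfl⟩ := hcr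
    exact hw.ofCoprodI_prod_notMem_base_range hφ ⟨h, by rw [← hc, of_apply_eq_base]⟩
  · have hcr' : c⁻¹ ∉ (φ i).range := fun h => hcr (inv_mem_iff.1 h)
    have hred : Reduced φ (NeWord.append w hki
        (.singleton c⁻¹ (ne_one_of_notMem_range hcr'))).toWord :=
      reduced_append_iff.2 ⟨hw, reduced_singleton hcr' _⟩
    exact hred.ofCoprodI_prod_notMem_base_range hφ ⟨1, by simp [← hc]⟩

theorem exists_eq_base_mul_reduced (hφ : ∀ i, Function.Injective (φ i)) (g : PushoutI φ) :
    ∃ (h : H) (w : Word G), Reduced φ w ∧ g = base φ h * ofCoprodI w.prod := by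
  classical
  obtain ⟨d⟩ := NormalWord.transversal_nonempty φ hφ
  let w : NormalWord d := NormalWord.equiv g
  refine ⟨w.head, w.toWord, ?_, (NormalWord.equiv.symm_apply_apply g).symm⟩
  rintro ⟨i, x⟩ hx hxr
  refine w.ne_one _ hx ?_
  rw [← SetLike.mem_coe, ← (d.compl i).coe_equiv_snd_eq_one_iff_mem (d.one_mem i),
    ((d.compl i).equiv_snd_eq_self_iff_mem (one_mem _)).2 (w.normalized _ _ hx)] at hxr
  exact hxr

theorem exists_eq_of_mul_reduced (hφ : ∀ i, Function.Injective (φ i)) (i : ι) (g : PushoutI φ) :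
    ∃ (x : G i) (w : Word G), Reduced φ w ∧ w.fstIdx ≠ some i ∧
      g = of i x * ofCoprodI w.prod := by
  classical
  obtain ⟨h, w, hw, rfl⟩ := exists_eq_base_mul_reduced hφ g
  by_cases hwi : w.fstIdx = some i
  · induction w using Word.consRecOn with
    | empty => simp [Word.fstIdx, Word.empty] at hwi
    | cons j m w h1 h2 _ =>
      obtain rfl : j = i := by simpa using hwi
      exact ⟨φ j h * m, w, fun g hg => hw g (List.mem_cons_of_mem _ hg), h1,
        by simp [of_apply_eq_base, mul_assoc]⟩
  · exact ⟨φ i h, w, hw, hwi, by rw [of_apply_eq_base]⟩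

/-- If the base is normal in the factor `G i`, then only elements of `G i` conjugate an element of
`G i` outside the base into `G i`. -/
theorem mem_of_range_of_conj_mem (hφ : ∀ i, Function.Injective (φ i)) {i : ι}
    (hn : (φ i).range.Normal) {c : G i} (hc : c ∉ (φ i).range) {g : PushoutI φ}
    (hg : g * of i c * g⁻¹ ∈ (of (φ := φ) i).range) : g ∈ (of (φ := φ) i).range := by
  obtain ⟨x, w, hw, hwi, rfl⟩ := exists_eq_of_mul_reduced hφ i g
  by_cases hwe : w = .empty
  · exact ⟨x, by simp [hwe]⟩
  obtain ⟨j, k, w, rfl⟩ := NeWord.of_word w hwe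
  have hji : j ≠ i := by
    rintro rfl
    exact hwi (by simp [Word.fstIdx, NeWord.toWord, NeWord.toList_head?])
  obtain ⟨v, hv, hvc⟩ := hw.exists_conj_eq hn hc
  refine (hv.ofCoprodI_prod_notMem_of_range hφ hji ?_).elim
  obtain ⟨y, hy⟩ := hg
  refine ⟨x⁻¹ * y * x, ?_⟩
  rw [hvc, map_mul, map_mul, hy, map_inv]
  simp only [NeWord.prod]
  group

theorem centralizer_of (hφ : ∀ i, Function.Injective (φ i)) {i : ι}
    (hn : (φ i).range.Normal) {c : G i} (hc : c ∉ (φ i).range) :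
    Subgroup.centralizer {of (φ := φ) i c} =
      Subgroup.map (of (φ := φ) i) (Subgroup.centralizer {c}) := by
  ext g
  simp only [Subgroup.mem_map, Subgroup.mem_centralizer_singleton_iff]
  constructor
  · intro hg
    obtain ⟨x, rfl⟩ := mem_of_range_of_conj_mem hφ hn hc (g := g)
      ⟨c, by rw [hg, mul_inv_cancel_right]⟩
    exact ⟨x, of_injective hφ i (by simpa using hg), rfl⟩
  · rintro ⟨x, hx, rfl⟩
    rw [← map_mul, hx, map_mul]

theorem base_range_le_center [Nonempty ι] (hcent : ∀ i, (φ i).range ≤ Subgroup.center (G i)) :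
    (base φ).range ≤ Subgroup.center (PushoutI φ) := by
  rintro _ ⟨h, rfl⟩
  have hcomm (i : ι) (x : G i) : Commute (of i x) (base φ h) := by
    rw [← of_apply_eq_base φ i]
    exact Commute.map (Subgroup.mem_center_iff.1 (hcent i ⟨h, rfl⟩) x) (of i)
  rw [Subgroup.mem_center_iff]
  intro g
  change Commute g (base φ h)
  induction g using PushoutI.induction_on with
  | of i x => exact hcomm i x
  | base h' =>
    obtain ⟨i⟩ := ‹Nonempty ι›
    rw [← of_apply_eq_base φ i h']
    exact hcomm i _
  | mul x y hx hy => exact hx.mul_left hy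

theorem center_eq_base_range [Nontrivial ι] (hφ : ∀ i, Function.Injective (φ i))
    (hcent : ∀ i, (φ i).range ≤ Subgroup.center (G i)) (hprop : ∀ i, (φ i).range ≠ ⊤) :
    Subgroup.center (PushoutI φ) = (base φ).range := by
  refine le_antisymm (fun z hz => ?_) (base_range_le_center hcent)
  have hmem (i : ι) : z ∈ (of (φ := φ) i).range := by
    obtain ⟨c, hc⟩ := SetLike.exists_not_mem_of_ne_top _ (hprop i) rfl
    refine mem_of_range_of_conj_mem hφ (Subgroup.normal_of_le_center (hcent i)) hc ⟨c, ?_⟩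
    rw [← Subgroup.mem_center_iff.1 hz, mul_inv_cancel_right]
  obtain ⟨i, j, hij⟩ := exists_pair_ne ι
  rw [← inf_of_range_eq_base_range hφ hij]
  exact ⟨hmem i, hmem j⟩

end Monoid.PushoutI

theorem centralizers_and_center_of_amalgam_over_central_subgroup
    (A B C : Type) [Group A] [Group B] [Group C]
    (ιA : C →* A) (ιB : C →* B)
    (hAinj : Function.Injective ιA) (hBinj : Function.Injective ιB)
    (hAcent : ιA.range ≤ Subgroup.center A) (hAprop : ιA.range ≠ ⊤)
    (hBcent : ιB.range ≤ Subgroup.center B) (hBprop : ιB.range ≠ ⊤) :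
    -- `G = A *_C B` is the pushout of `ι_A` and `ι_B`, with canonical maps
    -- `κ_A = Monoid.PushoutI.of true` and `κ_B = Monoid.PushoutI.of false`.
    (∀ a : A, a ∉ ιA.range →
      Subgroup.centralizer {Monoid.PushoutI.of (φ := amalgMaps ιA ιB) true a} =
        Subgroup.map (Monoid.PushoutI.of (φ := amalgMaps ιA ιB) true)
          (Subgroup.centralizer {a})) ∧
    Subgroup.center (Monoid.PushoutI (amalgMaps ιA ιB)) =
      ((Monoid.PushoutI.of (φ := amalgMaps ιA ιB) true).comp ιA).range := by
  have hφ (i) : Function.Injective (amalgMaps ιA ιB i) := by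
    cases i
    exacts [hBinj, hAinj]
  have hcent (i) : (amalgMaps ιA ιB i).range ≤ Subgroup.center (amalgFam A B i) := by
    cases i
    exacts [hBcent, hAcent]
  have hprop (i) : (amalgMaps ιA ιB i).range ≠ ⊤ := by
    cases i
    exacts [hBprop, hAprop]
  refine ⟨fun a ha => ?_, ?_⟩
  · exact Monoid.PushoutI.centralizer_of hφ (i := true)
      (Subgroup.normal_of_le_center (hcent true)) ha
  · rw [Monoid.PushoutI.center_eq_base_range hφ hcent hprop]
    exact congrArg MonoidHom.range
      (Monoid.PushoutI.of_comp_eq_base (φ := amalgMaps ιA ιB) true).symm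
end

section
/- Let H be a group and let G : ℕ → Subgroup H be a monotone increasing sequence of subgroups with ⨆_n G n = H. For each n, let Z_n denote the set of elements of G n that commute with every element of G n (the center of the subgroup G n). Assume that for every n: G n is perfect; the quotient of G n by its center is a simple group; and Z_{n+1} ⊆ Z_n. Assume moreover that ⋂_n Z_n = {1}. Then H is a simple group. -/
/-- The center of a subgroup `K` of `H`, viewed as a subgroup of `H`: the set of elements
of `K` commuting with every element of `K`. -/
def centerIn {H : Type*} [Group H] (K : Subgroup H) : Subgroup H :=
  Subgroup.centralizer (K : Set H) ⊓ K

open scoped commutatorElement in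
/-- A normal subgroup which together with the center generates the group contains the
commutator subgroup. -/
theorem commutator_le_of_sup_center_eq_top {K : Type*} [Group K] (M : Subgroup K) [hM : M.Normal]
    (h : M ⊔ Subgroup.center K = ⊤) : commutator K ≤ M := by
  rw [commutator_def, Subgroup.commutator_le]
  intro a _ b _
  have ha : a ∈ M ⊔ Subgroup.center K := h ▸ Subgroup.mem_top a
  obtain ⟨m, hm, z, hz, rfl⟩ := Subgroup.mem_sup_of_normal_left.mp ha
  have hzb : b * z = z * b := Subgroup.mem_center_iff.mp hz b
  have key : ⁅m * z, b⁆ = m * (b * m⁻¹ * b⁻¹) := by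
    have : z * b * z⁻¹ = b := by rw [← hzb, mul_inv_cancel_right]
    calc ⁅m * z, b⁆ = m * (z * b * z⁻¹) * m⁻¹ * b⁻¹ := by
          rw [commutatorElement_def]; group
      _ = m * (b * m⁻¹ * b⁻¹) := by rw [this]; group
  rw [key]
  exact M.mul_mem hm (hM.conj_mem _ (M.inv_mem hm) b)

/-- In a perfect group that is simple modulo its center, every noncentral normal subgroup is the
whole group. -/
theorem normal_eq_top_of_not_le_center {K : Type*} [Group K]
    (hperf : commutator K = ⊤) (hsimple : IsSimpleGroup (K ⧸ Subgroup.center K))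
    {M : Subgroup K} (hM : M.Normal) (hnc : ¬ M ≤ Subgroup.center K) : M = ⊤ := by
  have hmap : (M.map (QuotientGroup.mk' (Subgroup.center K))).Normal :=
    hM.map _ (QuotientGroup.mk'_surjective _)
  rcases hmap.eq_bot_or_eq_top with h | h
  · rw [Subgroup.map_eq_bot_iff, QuotientGroup.ker_mk'] at h
    exact absurd h hnc
  · have hsup : M ⊔ Subgroup.center K = ⊤ := by
      have := congrArg (Subgroup.comap (QuotientGroup.mk' (Subgroup.center K))) h
      rwa [Subgroup.comap_map_eq, QuotientGroup.ker_mk', Subgroup.comap_top] at this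
    exact top_le_iff.mp (hperf ▸ commutator_le_of_sup_center_eq_top M hsup)

theorem union_of_chain_of_perfect_central_by_simple_groups_is_simple
    (H : Type) [Group H] (G : ℕ → Subgroup H)
    (hmono : Monotone G) (hsup : (⨆ n, G n) = ⊤)
    (hperf : ∀ n, commutator ↥(G n) = ⊤)
    (hsimple : ∀ n, IsSimpleGroup (↥(G n) ⧸ Subgroup.center ↥(G n)))
    (hdesc : ∀ n, centerIn (G (n + 1)) ≤ centerIn (G n))
    (hinter : (⨅ n, centerIn (G n)) = ⊥) :
    IsSimpleGroup H := by
  have hanti : Antitone fun n => centerIn (G n) := antitone_nat_of_succ_le hdesc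
  have hnontriv : Nontrivial H := by
    have := (hsimple 0).toNontrivial
    have : Nontrivial (G 0) := (QuotientGroup.mk'_surjective (Subgroup.center (G 0))).nontrivial
    exact (Subtype.val_injective (p := fun x => x ∈ G 0)).nontrivial
  refine { toNontrivial := hnontriv, eq_bot_or_eq_top_of_normal := fun N hN => ?_ }
  refine or_iff_not_imp_left.mpr fun hbot => ?_
  obtain ⟨x, hxN, hx1⟩ := N.ne_bot_iff_exists_ne_one.mp hbot |>.imp' Subtype.val
    (q := fun x => x ∈ N ∧ x ≠ 1) fun x hx => ⟨x.2, by simpa using hx⟩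
  obtain ⟨k, hk⟩ : ∃ k, x ∉ centerIn (G k) := by
    by_contra! hall
    have : x ∈ ⨅ n, centerIn (G n) := Subgroup.mem_iInf.mpr hall
    rw [hinter, Subgroup.mem_bot] at this
    exact hx1 this
  have hmem (y : H) : ∃ n, y ∈ G n :=
    (Subgroup.mem_iSup_of_directed hmono.directed_le).mp (hsup ▸ Subgroup.mem_top y)
  obtain ⟨l, hl⟩ := hmem x
  refine top_le_iff.mp fun y _ => ?_
  obtain ⟨m, hm⟩ := hmem y
  obtain ⟨n, hkn, hln, hmn⟩ : ∃ n, k ≤ n ∧ l ≤ n ∧ m ≤ n :=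
    ⟨max k (max l m), by omega, by omega, by omega⟩
  have hxn : x ∈ G n := hmono hln hl
  have htop : N.subgroupOf (G n) = ⊤ := by
    refine normal_eq_top_of_not_le_center (hperf n) (hsimple n) (hN.subgroupOf (G n)) fun hle => ?_
    have hc : (⟨x, hxn⟩ : G n) ∈ Subgroup.center (G n) := hle (Subgroup.mem_subgroupOf.mpr hxN)
    refine hk (hanti hkn ⟨Subgroup.mem_centralizer_iff.mpr fun g hg => ?_, hxn⟩)
    exact congrArg Subtype.val (Subgroup.mem_center_iff.mp hc ⟨g, hg⟩)
  exact Subgroup.subgroupOf_eq_top.mp htop (hmono hmn hm)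
end

section
/- Let G be a group and equip its automorphism group MulAut G with the topology of pointwise convergence. For every subgroup Γ of G, the topological closure in MulAut G of the image of Γ under the conjugation homomorphism G → MulAut G is compact if and only if for every g ∈ G the orbit {γ * g * γ⁻¹ : γ ∈ Γ} is a finite set. -/
/-- The topology of pointwise convergence on the automorphism group of a (discrete)
group `G`: the topology induced by the inclusion `MulAut G → (G → G)`, where `G`
carries the discrete topology and `G → G` the product topology. -/
def ptTop (G : Type*) [Group G] : TopologicalSpace (MulAut G) :=
  letI : TopologicalSpace G := ⊥
  TopologicalSpace.induced (fun (φ : MulAut G) (g : G) => φ g) inferInstance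

/-- A multiplicative self-map preserving each conjugation orbit of a subgroup is an automorphism
as soon as these orbits are finite. -/
theorem exists_mulAut_of_map_mem_conjugation_orbit {G : Type*} [Group G] {Γ : Subgroup G}
    (hfin : ∀ g : G, {x : G | ∃ γ ∈ Γ, γ * g * γ⁻¹ = x}.Finite) (f : G → G)
    (hmul : ∀ x y, f (x * y) = f x * f y) (hf : ∀ g, ∃ γ ∈ Γ, γ * g * γ⁻¹ = f g) :
    ∃ φ : MulAut G, ⇑φ = f := by
  let F : G →* G := MonoidHom.mk' f hmul
  have hinj : Function.Injective F := by
    rw [injective_iff_map_eq_one]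
    intro g hg
    obtain ⟨γ, -, h⟩ := hf g
    exact conj_eq_one_iff.mp (h.trans hg)
  have hsurj : Function.Surjective F := by
    intro g
    have hmaps : Set.MapsTo F {x : G | ∃ γ ∈ Γ, γ * g * γ⁻¹ = x}
        {x : G | ∃ γ ∈ Γ, γ * g * γ⁻¹ = x} := by
      rintro _ ⟨γ, hγ, rfl⟩
      obtain ⟨δ, hδ, h⟩ := hf (γ * g * γ⁻¹)
      exact ⟨δ * γ, Γ.mul_mem hδ hγ, by rw [← show _ = F _ from h]; group⟩
    obtain ⟨x, -, hx⟩ := ((hfin g).injOn_iff_bijOn_of_mapsTo hmaps |>.mp hinj.injOn).surjOn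
      (show g ∈ _ from ⟨1, Γ.one_mem, by simp⟩)
    exact ⟨x, hx⟩
  exact ⟨MulEquiv.ofBijective F ⟨hinj, hsurj⟩, rfl⟩

theorem closure_of_image_compact_iff_finite_conjugation_orbits
    (G : Type) [Group G] (Γ : Subgroup G) :
    @IsCompact (MulAut G) (ptTop G)
      (@closure (MulAut G) (ptTop G) ((MulAut.conj : G →* MulAut G) '' (Γ : Set G))) ↔
    ∀ g : G, {x : G | ∃ γ ∈ Γ, γ * g * γ⁻¹ = x}.Finite := by
  let : TopologicalSpace G := ⊥
  have : DiscreteTopology G := ⟨rfl⟩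
  let : TopologicalSpace (MulAut G) := ptTop G
  have hind : Topology.IsInducing (fun (φ : MulAut G) (g : G) => φ g) := ⟨rfl⟩
  constructor
  · intro hK g
    have hcont : Continuous fun φ : MulAut G => φ g := (continuous_apply g).comp hind.continuous
    refine (hK.image hcont).finite_of_discrete.subset ?_
    rintro _ ⟨γ, hγ, rfl⟩
    exact ⟨MulAut.conj γ, subset_closure ⟨γ, hγ, rfl⟩, MulAut.conj_apply γ g⟩
  · intro hfin
    let S : Set (G → G) := {f | ∀ x y, f (x * y) = f x * f y} ∩
      Set.univ.pi fun g => {x : G | ∃ γ ∈ Γ, γ * g * γ⁻¹ = x}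
    have hS : IsCompact S := by
      refine (isCompact_univ_pi fun g => (hfin g).isCompact).inter_left ?_
      simp only [Set.ofPred_forall]
      exact isClosed_iInter fun x => isClosed_iInter fun y =>
        isClosed_eq (continuous_apply _) ((continuous_apply x).mul (continuous_apply y))
    have hrange : S ⊆ Set.range fun (φ : MulAut G) (g : G) => φ g := fun f hf =>
      exists_mulAut_of_map_mem_conjugation_orbit hfin f hf.1 fun g => hf.2 g trivial
    refine (hind.isCompact_preimage' hS hrange).of_isClosed_subset isClosed_closure
      (closure_minimal ?_ (hS.isClosed.preimage hind.continuous))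
    rintro _ ⟨γ, hγ, rfl⟩
    exact ⟨map_mul (MulAut.conj γ), fun g _ => ⟨γ, hγ, (MulAut.conj_apply γ g).symm⟩⟩
end
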